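/- arXiv:1705.09612 — 7 statements merged into one kernel-verified Lean document; each statement's English description precedes it below -/
import Mathlib

section
/- Let N ≥ 1 and let u, v : ℝ^N → ℝ be Borel measurable functions vanishing at infinity. Then the Shibata rearrangement {u,v}⋆ is radially symmetric and non-increasing, i.e. {u,v}⋆(x) = {u,v}⋆(y) whenever ‖x‖ = ‖y‖ and {u,v}⋆(x) ≤ {u,v}⋆(y) whenever ‖y‖ ≤ ‖x‖; it is lower semicontinuous on ℝ^N; and for every t > 0 the superlevel set {x ∈ ℝ^N : {u,v}⋆(x) > t} equals A⋆(u,v;t). -/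
open MeasureTheory ENNReal

noncomputable section

/-- Euclidean space `ℝ^N`. -/
abbrev EucN (N : ℕ) : Type := EuclideanSpace ℝ (Fin N)

/-- A function vanishes at infinity if all its strict superlevel sets (of positive level)
have finite Lebesgue measure. -/
def VanishesAtInfinity {N : ℕ} (w : EucN N → ℝ) : Prop :=
  ∀ t : ℝ, 0 < t → volume {x : EucN N | t < |w x|} < ⊤

/-- `A⋆(u,v;t)`: the open ball centered at the origin whose Lebesgue measure equals
`|{|u| > t}| + |{|v| > t}|` (empty if that sum is `0`). -/
def Astar {N : ℕ} (u v : EucN N → ℝ) (t : ℝ) : Set (EucN N) :=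
  {x : EucN N | volume (Metric.ball (0 : EucN N) ‖x‖) <
    volume {y : EucN N | t < |u y|} + volume {y : EucN N | t < |v y|}}

/-- The Shibata rearrangement `{u,v}⋆(x) = ∫₀^∞ χ_{A⋆(u,v;t)}(x) dt`. -/
def shibata {N : ℕ} (u v : EucN N → ℝ) (x : EucN N) : ℝ≥0∞ :=
  ∫⁻ t in Set.Ioi (0 : ℝ), Set.indicator (Astar u v t) (fun _ => (1 : ℝ≥0∞)) x

open Filter Topology

/-- The distribution function `s ↦ |{x : s < f x}|` is continuous from the right. -/
theorem tendsto_measure_superlevel_add_inv {α : Type*} [MeasurableSpace α] (μ : Measure α)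
    (f : α → ℝ) (t : ℝ) :
    Tendsto (fun n : ℕ => μ {x | t + 1 / ((n : ℝ) + 1) < f x}) atTop (𝓝 (μ {x | t < f x})) := by
  have hmono : Monotone (fun n : ℕ => {x | t + 1 / ((n : ℝ) + 1) < f x}) := by
    intro m n hmn x hx
    have h : 1 / ((n : ℝ) + 1) ≤ 1 / ((m : ℝ) + 1) := Nat.one_div_le_one_div hmn
    simp only [Set.mem_ofPred_eq] at hx ⊢
    linarith
  have hunion : {x | t < f x} = ⋃ n : ℕ, {x | t + 1 / ((n : ℝ) + 1) < f x} := by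
    ext x
    simp only [Set.mem_ofPred_eq, Set.mem_iUnion]
    constructor
    · intro h
      obtain ⟨n, hn⟩ := exists_nat_one_div_lt (sub_pos.mpr h)
      exact ⟨n, by linarith⟩
    · rintro ⟨n, hn⟩
      have : 0 < 1 / ((n : ℝ) + 1) := Nat.one_div_pos_of_nat
      linarith
  rw [hunion]
  exact tendsto_measure_iUnion_atTop hmono

theorem antitone_Astar {N : ℕ} (u v : EucN N → ℝ) : Antitone (Astar u v) := by
  intro s t hst x hx
  have hmono (w : EucN N → ℝ) : volume {y | t < |w y|} ≤ volume {y | s < |w y|} :=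
    measure_mono fun y (hy : t < |w y|) => lt_of_le_of_lt hst hy
  simp only [Astar, Set.mem_ofPred_eq] at hx ⊢
  exact hx.trans_le (add_le_add (hmono u) (hmono v))

theorem mem_Astar_of_norm_le {N : ℕ} {u v : EucN N → ℝ} {t : ℝ} {x y : EucN N}
    (hyx : ‖y‖ ≤ ‖x‖) (hx : x ∈ Astar u v t) : y ∈ Astar u v t :=
  lt_of_le_of_lt (measure_mono (Metric.ball_subset_ball hyx)) hx

theorem isOpen_Astar {N : ℕ} (hN : 1 ≤ N) (u v : EucN N → ℝ) (t : ℝ) :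
    IsOpen (Astar u v t) := by
  have : Nonempty (Fin N) := ⟨⟨0, hN⟩⟩
  have hcont : Continuous fun x : EucN N => volume (Metric.ball (0 : EucN N) ‖x‖) := by
    simp only [Measure.addHaar_ball volume (0 : EucN N) (norm_nonneg _)]
    exact (ENNReal.continuous_mul_const measure_ball_lt_top.ne).comp
      (ENNReal.continuous_ofReal.comp (by fun_prop))
  exact isOpen_lt hcont continuous_const

theorem exists_gt_mem_Astar {N : ℕ} {u v : EucN N → ℝ} {t : ℝ} {x : EucN N}
    (hx : x ∈ Astar u v t) : ∃ s, t < s ∧ x ∈ Astar u v s := by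
  have h := (tendsto_measure_superlevel_add_inv volume (fun y => |u y|) t).add
    (tendsto_measure_superlevel_add_inv volume (fun y => |v y|) t)
  obtain ⟨n, hn⟩ := (h.eventually_const_lt hx).exists
  exact ⟨_, lt_add_of_pos_right t Nat.one_div_pos_of_nat, hn⟩

theorem shibata_eq_volume {N : ℕ} (u v : EucN N → ℝ) (x : EucN N) :
    shibata u v x = volume ({t : ℝ | x ∈ Astar u v t} ∩ Set.Ioi 0) := by
  have hconn : Set.OrdConnected {t : ℝ | x ∈ Astar u v t} :=
    ⟨fun _ _ _ hb _ hc => antitone_Astar u v hc.2 hb⟩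
  have hmeas : MeasurableSet {t : ℝ | x ∈ Astar u v t} := hconn.measurableSet
  calc shibata u v x
      = ∫⁻ t in Set.Ioi (0 : ℝ), {t : ℝ | x ∈ Astar u v t}.indicator 1 t := rfl
    _ = _ := by rw [lintegral_indicator_one hmeas, Measure.restrict_apply hmeas]

theorem shibata_le_of_norm_le {N : ℕ} (u v : EucN N → ℝ) {x y : EucN N} (hyx : ‖y‖ ≤ ‖x‖) :
    shibata u v x ≤ shibata u v y := by
  rw [shibata_eq_volume, shibata_eq_volume]
  exact measure_mono fun t ht => ⟨mem_Astar_of_norm_le hyx ht.1, ht.2⟩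

theorem ofReal_lt_shibata_iff {N : ℕ} (u v : EucN N → ℝ) {t : ℝ} (ht : 0 < t) (x : EucN N) :
    ENNReal.ofReal t < shibata u v x ↔ x ∈ Astar u v t := by
  rw [shibata_eq_volume]
  constructor
  · intro h
    by_contra hx
    refine h.not_ge ?_
    calc volume ({s : ℝ | x ∈ Astar u v s} ∩ Set.Ioi 0)
        ≤ volume (Set.Ioo 0 t) := measure_mono fun s hs =>
          ⟨hs.2, lt_of_not_ge fun hts => hx (antitone_Astar u v hts hs.1)⟩
      _ = ENNReal.ofReal t := by rw [Real.volume_Ioo, sub_zero]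
  · intro hx
    obtain ⟨s, hts, hs⟩ := exists_gt_mem_Astar hx
    calc ENNReal.ofReal t < ENNReal.ofReal s :=
          (ENNReal.ofReal_lt_ofReal_iff (ht.trans hts)).mpr hts
      _ = volume (Set.Ioc 0 s) := by rw [Real.volume_Ioc, sub_zero]
      _ ≤ volume ({r : ℝ | x ∈ Astar u v r} ∩ Set.Ioi 0) := measure_mono fun r hr => ⟨antitone_Astar u v hr.2 hs, hr.1⟩

theorem lowerSemicontinuous_shibata {N : ℕ} (hN : 1 ≤ N) (u v : EucN N → ℝ) :
    LowerSemicontinuous (shibata u v) := by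
  intro x a ha
  obtain ⟨b, hab, hbx⟩ := exists_between ha
  have hb : b ≠ ⊤ := hbx.ne_top
  have hb0 : 0 < b.toReal := ENNReal.toReal_pos hab.ne_bot hb
  have key (y : EucN N) : b < shibata u v y ↔ y ∈ Astar u v b.toReal := by
    rw [← ofReal_lt_shibata_iff u v hb0, ENNReal.ofReal_toReal hb]
  filter_upwards [(isOpen_Astar hN u v b.toReal).mem_nhds ((key x).mp hbx)] with y hy
  exact hab.trans ((key y).mpr hy)

theorem shibata_radial_lsc_superlevel
    (N : ℕ) (hN : 1 ≤ N) (u v : EucN N → ℝ)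
    (hu : Measurable u) (hv : Measurable v)
    (hu0 : VanishesAtInfinity u) (hv0 : VanishesAtInfinity v) :
    (∀ x y : EucN N, ‖x‖ = ‖y‖ → shibata u v x = shibata u v y) ∧
    (∀ x y : EucN N, ‖y‖ ≤ ‖x‖ → shibata u v x ≤ shibata u v y) ∧
    LowerSemicontinuous (shibata u v) ∧
    (∀ t : ℝ, 0 < t →
      {x : EucN N | ENNReal.ofReal t < shibata u v x} = Astar u v t) := by
  exact ⟨fun x y hxy => le_antisymm (shibata_le_of_norm_le u v hxy.ge)
      (shibata_le_of_norm_le u v hxy.le),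
    fun x y hyx => shibata_le_of_norm_le u v hyx,
    lowerSemicontinuous_shibata hN u v,
    fun t ht => Set.ext fun x => ofReal_lt_shibata_iff u v ht x⟩
end
end

section
/- Let N ≥ 1, let r > 1 be a real number, and let u, v : ℝ^N → ℝ be Borel measurable functions vanishing at infinity. Then for every x ∈ ℝ^N one has ({|u|,|v|}⋆(x))^r = {|u|^r, |v|^r}⋆(x), where the r-th power on the extended nonnegative reals sends ∞ to ∞. -/
open MeasureTheory ENNReal

noncomputable section

/-- A set of positive reals that is closed under passing to smaller positive reals has Lebesgue
measure equal to its supremum. -/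
lemma volume_eq_iSup_of_downward_closed {S : Set ℝ} (hpos : ∀ t ∈ S, 0 < t)
    (hS : ∀ t ∈ S, ∀ s, 0 < s → s ≤ t → s ∈ S) :
    volume S = ⨆ t ∈ S, ENNReal.ofReal t := by
  apply le_antisymm
  · rcases eq_or_ne (⨆ t ∈ S, ENNReal.ofReal t) ⊤ with h | h
    · simp [h]
    · have hsub : S ⊆ Set.Ioc 0 (⨆ t ∈ S, ENNReal.ofReal t).toReal := fun t ht =>
        ⟨hpos t ht, (ENNReal.ofReal_le_iff_le_toReal h).1
          (le_iSup₂ (f := fun t (_ : t ∈ S) => ENNReal.ofReal t) t ht)⟩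
      calc volume S ≤ _ := measure_mono hsub
        _ = _ := by rw [Real.volume_Ioc, sub_zero, ENNReal.ofReal_toReal h]
  · refine iSup₂_le fun t ht => ?_
    calc ENNReal.ofReal t = volume (Set.Ioc 0 t) := by rw [Real.volume_Ioc, sub_zero]
      _ ≤ volume S := measure_mono fun s hs => hS t ht s hs.1 hs.2

lemma mem_Astar_of_le {N : ℕ} {u v : EucN N → ℝ} {s t : ℝ} (h : s ≤ t) {x : EucN N}
    (hx : x ∈ Astar u v t) : x ∈ Astar u v s :=
  lt_of_lt_of_le hx <| add_le_add (measure_mono fun _ hy => lt_of_le_of_lt h hy)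
    (measure_mono fun _ hy => lt_of_le_of_lt h hy)

lemma shibata_eq_iSup {N : ℕ} (u v : EucN N → ℝ) (x : EucN N) :
    shibata u v x = ⨆ t ∈ {t : ℝ | 0 < t ∧ x ∈ Astar u v t}, ENNReal.ofReal t := by
  have hord : Set.OrdConnected {t : ℝ | 0 < t ∧ x ∈ Astar u v t} :=
    ⟨fun _ ha _ hb _ hc => ⟨ha.1.trans_le hc.1, mem_Astar_of_le hc.2 hb.2⟩⟩
  rw [← volume_eq_iSup_of_downward_closed
      (S := {t : ℝ | 0 < t ∧ x ∈ Astar u v t}) (fun _ ht => ht.1)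
      (fun _ ht _ hs hst => ⟨hs, mem_Astar_of_le hst ht.2⟩), shibata,
    ← lintegral_indicator measurableSet_Ioi, ← lintegral_indicator_one hord.measurableSet]
  congr 1
  ext t
  by_cases h0 : 0 < t <;> by_cases hx : x ∈ Astar u v t <;> simp [Set.indicator, h0, hx]

lemma Astar_rpow {N : ℕ} (u v : EucN N → ℝ) {r t : ℝ} (hr : 0 < r) (ht : 0 < t) :
    Astar (fun y => |u y| ^ r) (fun y => |v y| ^ r) (t ^ r) =
      Astar (fun y => |u y|) (fun y => |v y|) t := by
  have h (a : ℝ) : t ^ r < |(|a| ^ r)| ↔ t < |(|a|)| := by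
    rw [abs_of_nonneg (Real.rpow_nonneg (abs_nonneg a) r), abs_abs,
      Real.rpow_lt_rpow_iff ht.le (abs_nonneg a) hr]
  simp only [Astar, h]

theorem shibata_rpow_eq
    (N : ℕ) (hN : 1 ≤ N) (r : ℝ) (hr : 1 < r) (u v : EucN N → ℝ)
    (hu : Measurable u) (hv : Measurable v)
    (hu0 : VanishesAtInfinity u) (hv0 : VanishesAtInfinity v) :
    ∀ x : EucN N,
      (shibata (fun y => |u y|) (fun y => |v y|) x) ^ r =
        shibata (fun y => |u y| ^ r) (fun y => |v y| ^ r) x := by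
  intro x
  have hr0 : 0 < r := one_pos.trans hr
  have hpow (a : ℝ≥0∞) : a ^ r = ENNReal.orderIsoRpow r hr0 a := rfl
  rw [shibata_eq_iSup, shibata_eq_iSup, hpow]
  simp only [OrderIso.map_iSup, ENNReal.orderIsoRpow_apply]
  apply le_antisymm
  · refine iSup₂_le fun t ht => ?_
    rw [ENNReal.ofReal_rpow_of_pos ht.1]
    exact le_iSup₂_of_le (t ^ r)
      ⟨Real.rpow_pos_of_pos ht.1 r, by rw [Astar_rpow u v hr0 ht.1]; exact ht.2⟩ le_rfl
  · refine iSup₂_le fun s hs => ?_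
    have ht : 0 < s ^ r⁻¹ := Real.rpow_pos_of_pos hs.1 _
    have hts : (s ^ r⁻¹) ^ r = s := Real.rpow_inv_rpow hs.1.le hr0.ne'
    refine le_iSup₂_of_le (s ^ r⁻¹) ⟨ht, ?_⟩ ?_
    · rw [← Astar_rpow u v hr0 ht, hts]
      exact hs.2
    · rw [ENNReal.ofReal_rpow_of_pos ht, hts]
end
end

section
/- Let N ≥ 1 and let r1, r2 > 1 be real numbers with r1 + r2 < 2*, where 2* := 2N/(N−2) if N ≥ 3 and 2* := ∞ if N ≤ 2. Let u1, u2, v1, v2 : ℝ^N → ℝ be Borel measurable functions vanishing at infinity. Then ∫_{ℝ^N} (|u1(x)|^{r1}|u2(x)|^{r2} + |v1(x)|^{r1}|v2(x)|^{r2}) dx ≤ ∫_{ℝ^N} ({|u1|,|v1|}⋆(x))^{r1} ({|u2|,|v2|}⋆(x))^{r2} dx, as an inequality of extended nonnegative reals. -/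
open MeasureTheory ENNReal

noncomputable section

/-- Layer-cake formula for a product of two superpositions of indicator functions. -/
lemma lintegral_mul_layers {α : Type*} [MeasurableSpace α] (μ : Measure α) [SFinite μ]
    (ν : Measure ℝ) [SFinite ν] {w₁ w₂ : ℝ → ℝ≥0∞} (hw₁ : Measurable w₁) (hw₂ : Measurable w₂)
    {E F : ℝ → Set α} (hE : MeasurableSet {p : ℝ × α | p.2 ∈ E p.1})
    (hF : MeasurableSet {p : ℝ × α | p.2 ∈ F p.1}) :
    ∫⁻ x, (∫⁻ s, w₁ s * (E s).indicator 1 x ∂ν) * (∫⁻ t, w₂ t * (F t).indicator 1 x ∂ν) ∂μ =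
      ∫⁻ s, ∫⁻ t, w₁ s * w₂ t * μ (E s ∩ F t) ∂ν ∂ν := by
  have mE : Measurable fun p : ℝ × α => w₁ p.1 * (E p.1).indicator (1 : α → ℝ≥0∞) p.2 :=
    (hw₁.comp measurable_fst).mul ((measurable_one (α := ℝ≥0∞)).indicator hE)
  have mF : Measurable fun p : ℝ × α => w₂ p.1 * (F p.1).indicator (1 : α → ℝ≥0∞) p.2 :=
    (hw₂.comp measurable_fst).mul ((measurable_one (α := ℝ≥0∞)).indicator hF)
  have hEs : ∀ s, MeasurableSet (E s) := fun s => measurable_prodMk_left (x := s) hE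
  have hFs : ∀ s, MeasurableSet (F s) := fun s => measurable_prodMk_left (x := s) hF
  have mF' : Measurable fun x => ∫⁻ t, w₂ t * (F t).indicator (1 : α → ℝ≥0∞) x ∂ν :=
    mF.lintegral_prod_left'
  calc
    _ = ∫⁻ x, ∫⁻ s, w₁ s * (E s).indicator 1 x *
          (∫⁻ t, w₂ t * (F t).indicator 1 x ∂ν) ∂ν ∂μ := by
      refine lintegral_congr fun x => (lintegral_mul_const _ ?_).symm
      exact mE.comp measurable_prodMk_right
    _ = ∫⁻ s, ∫⁻ x, w₁ s * (E s).indicator 1 x *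
          (∫⁻ t, w₂ t * (F t).indicator 1 x ∂ν) ∂μ ∂ν := by
      refine lintegral_lintegral_swap (Measurable.aemeasurable ?_)
      exact (mE.comp measurable_swap).mul (mF'.comp measurable_fst)
    _ = _ := by
      refine lintegral_congr fun s => ?_
      calc
        _ = ∫⁻ x, ∫⁻ t, w₁ s * (E s).indicator 1 x * (w₂ t * (F t).indicator 1 x) ∂ν ∂μ := by
          refine lintegral_congr fun x => (lintegral_const_mul _ ?_).symm
          exact mF.comp measurable_prodMk_right
        _ = ∫⁻ t, ∫⁻ x, w₁ s * (E s).indicator 1 x * (w₂ t * (F t).indicator 1 x) ∂μ ∂ν := by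
          refine lintegral_lintegral_swap (Measurable.aemeasurable ?_)
          exact (mE.comp (measurable_const.prodMk measurable_fst)).mul (mF.comp measurable_swap)
        _ = _ := by
          refine lintegral_congr fun t => ?_
          have hEF := (hEs s).inter (hFs t)
          rw [← lintegral_indicator_one hEF,
            ← lintegral_const_mul _ (measurable_one.indicator hEF)]
          refine lintegral_congr fun x => ?_
          rw [Set.inter_indicator_one, Pi.mul_apply]
          ring

lemma setLIntegral_Ioc_rpow {r a : ℝ} (hr : 0 < r) (ha : 0 ≤ a) :
    ∫⁻ s in Set.Ioc 0 a, ENNReal.ofReal (r * s ^ (r - 1)) = ENNReal.ofReal (a ^ r) := by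
  have hr' : -1 < r - 1 := by linarith
  have hint : IntervalIntegrable (fun s : ℝ => r * s ^ (r - 1)) volume 0 a :=
    (intervalIntegral.intervalIntegrable_rpow' hr').const_mul r
  rw [← ofReal_integral_eq_lintegral_ofReal
      ((intervalIntegrable_iff_integrableOn_Ioc_of_le ha).1 hint)]
  · rw [← intervalIntegral.integral_of_le ha, intervalIntegral.integral_const_mul,
      integral_rpow (Or.inl hr'), sub_add_cancel, Real.zero_rpow hr.ne', sub_zero,
      mul_div_cancel₀ _ hr.ne']
  · filter_upwards [ae_restrict_mem measurableSet_Ioc] with s hs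
    exact mul_nonneg hr.le (Real.rpow_nonneg hs.1.le _)

lemma ofReal_abs_rpow_eq_layers {α : Type*} (u : α → ℝ) {r : ℝ} (hr : 0 < r) (x : α) :
    ENNReal.ofReal (|u x| ^ r) =
      ∫⁻ s in Set.Ioi 0, ENNReal.ofReal (r * s ^ (r - 1)) *
        Set.indicator {y | s < |u y|} 1 x := by
  rw [← setLIntegral_Ioc_rpow hr (abs_nonneg (u x)), ← setLIntegral_congr Ioo_ae_eq_Ioc,
    ← Set.Ioi_inter_Iio, Set.inter_comm, ← setLIntegral_indicator measurableSet_Iio]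
  refine lintegral_congr fun s => ?_
  by_cases h : s < |u x| <;> simp [Set.indicator, h]

lemma ofReal_le_shibata {N : ℕ} (u v : EucN N → ℝ) {s : ℝ} {x : EucN N} (hx : x ∈ Astar u v s) :
    ENNReal.ofReal s ≤ shibata u v x := by
  calc
    ENNReal.ofReal s = ∫⁻ _ in Set.Ioc 0 s, 1 := by simp
    _ ≤ ∫⁻ t in Set.Ioc 0 s, Set.indicator (Astar u v t) (fun _ => (1 : ℝ≥0∞)) x := by
      refine setLIntegral_mono' measurableSet_Ioc fun t ht => ?_
      have hxt : x ∈ Astar u v t := by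
        refine lt_of_lt_of_le hx (add_le_add (measure_mono ?_) (measure_mono ?_)) <;>
        exact fun y hy => lt_of_le_of_lt ht.2 hy
      simp [hxt]
    _ ≤ _ := lintegral_mono_set Set.Ioc_subset_Ioi_self

lemma layers_Astar_le_shibata_rpow {N : ℕ} (u v : EucN N → ℝ) {r : ℝ} (hr : 0 < r) (x : EucN N) :
    ∫⁻ s in Set.Ioi 0, ENNReal.ofReal (r * s ^ (r - 1)) * (Astar u v s).indicator 1 x ≤
      shibata u v x ^ r := by
  by_cases htop : shibata u v x = ⊤
  · simp [htop, ENNReal.top_rpow_of_pos hr]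
  rw [← ENNReal.ofReal_toReal htop, ENNReal.ofReal_rpow_of_nonneg ENNReal.toReal_nonneg hr.le,
    ← setLIntegral_Ioc_rpow hr ENNReal.toReal_nonneg, ← Set.Ioi_inter_Iic, Set.inter_comm,
    ← setLIntegral_indicator measurableSet_Iic]
  refine lintegral_mono fun s => ?_
  by_cases h : x ∈ Astar u v s
  · have hs : s ≤ (shibata u v x).toReal :=
      (ENNReal.ofReal_le_iff_le_toReal htop).1 (ofReal_le_shibata u v h)
    simp [h, hs]
  · simp [h]

lemma measurableSet_uncurry_Astar {N : ℕ} (u v : EucN N → ℝ) :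
    MeasurableSet {p : ℝ × EucN N | p.2 ∈ Astar u v p.1} := by
  have hball : Monotone fun R : ℝ => volume (Metric.ball (0 : EucN N) R) :=
    fun _ _ h => measure_mono (Metric.ball_subset_ball h)
  have hlevel (w : EucN N → ℝ) : Antitone fun t : ℝ => volume {y : EucN N | t < |w y|} :=
    fun _ _ h => measure_mono fun _ hy => lt_of_le_of_lt h hy
  exact measurableSet_lt (hball.measurable.comp measurable_snd.norm)
    (((hlevel u).measurable.add (hlevel v).measurable).comp measurable_fst)

lemma le_volume_setOf_volume_ball_lt {N : ℕ} (hN : 1 ≤ N) {c : ℝ≥0∞} (hc : c ≠ ⊤) :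
    c ≤ volume {x : EucN N | volume (Metric.ball (0 : EucN N) ‖x‖) < c} := by
  have : Nonempty (Fin N) := ⟨⟨0, hN⟩⟩
  have hN0 : N ≠ 0 := by omega
  set κ := volume (Metric.ball (0 : EucN N) 1) with hκ
  have hκ0 : κ ≠ 0 := (Metric.measure_ball_pos _ _ one_pos).ne'
  have hκt : κ ≠ ⊤ := measure_ball_lt_top.ne
  have hball : ∀ R : ℝ, 0 ≤ R →
      volume (Metric.ball (0 : EucN N) R) = ENNReal.ofReal R ^ N * κ := by
    intro R hR
    rw [Measure.addHaar_ball _ _ hR, finrank_euclideanSpace_fin, ENNReal.ofReal_pow hR]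
  have hq : c / κ ≠ ⊤ := ENNReal.div_ne_top hc hκ0
  set R : ℝ := ((c / κ) ^ ((N : ℝ)⁻¹)).toReal
  have hRc : volume (Metric.ball (0 : EucN N) R) = c := by
    rw [hball R ENNReal.toReal_nonneg, ENNReal.ofReal_toReal
        (ENNReal.rpow_ne_top_of_nonneg (by positivity) hq), ← ENNReal.rpow_natCast,
      ENNReal.rpow_inv_rpow (by exact_mod_cast hN0), ENNReal.div_mul_cancel hκ0 hκt]
  nth_rewrite 1 [← hRc]
  refine measure_mono fun x hx => ?_
  rw [mem_ball_zero_iff] at hx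
  rw [Set.mem_ofPred_eq, ← hRc, hball _ (norm_nonneg x), hball R ENNReal.toReal_nonneg]
  exact ENNReal.mul_lt_mul_left hκ0 hκt (ENNReal.pow_lt_pow_left hN0
    ((ENNReal.ofReal_lt_ofReal_iff_of_nonneg (norm_nonneg x)).2 hx))

lemma volume_inter_add_volume_inter_le_Astar {N : ℕ} (hN : 1 ≤ N) {u₁ u₂ v₁ v₂ : EucN N → ℝ}
    (hu₁ : VanishesAtInfinity u₁) (hv₁ : VanishesAtInfinity v₁) {s : ℝ} (hs : 0 < s) (t : ℝ) :
    volume ({y | s < |u₁ y|} ∩ {y | t < |u₂ y|}) + volume ({y | s < |v₁ y|} ∩ {y | t < |v₂ y|}) ≤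
      volume (Astar (fun y => |u₁ y|) (fun y => |v₁ y|) s ∩
        Astar (fun y => |u₂ y|) (fun y => |v₂ y|) t) := by
  set a := volume {y | s < |u₁ y|} + volume {y | s < |v₁ y|}
  set b := volume {y | t < |u₂ y|} + volume {y | t < |v₂ y|}
  have ha : a ≠ ⊤ := (ENNReal.add_lt_top.2 ⟨hu₁ s hs, hv₁ s hs⟩).ne
  have hA : Astar (fun y => |u₁ y|) (fun y => |v₁ y|) s ∩
      Astar (fun y => |u₂ y|) (fun y => |v₂ y|) t =
      {x : EucN N | volume (Metric.ball (0 : EucN N) ‖x‖) < min a b} := by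
    ext x
    simp [Astar, a, b]
  rw [hA]
  refine le_trans (le_min ?_ ?_)
    (le_volume_setOf_volume_ball_lt hN ((min_le_left a b).trans_lt ha.lt_top).ne)
  · exact add_le_add (measure_mono Set.inter_subset_left) (measure_mono Set.inter_subset_left)
  · exact add_le_add (measure_mono Set.inter_subset_right) (measure_mono Set.inter_subset_right)


theorem shibata_double_product_inequality
    (N : ℕ) (hN : 1 ≤ N) (r1 r2 : ℝ) (hr1 : 1 < r1) (hr2 : 1 < r2)
    (h2star : 3 ≤ N → r1 + r2 < 2 * (N : ℝ) / ((N : ℝ) - 2))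
    (u1 u2 v1 v2 : EucN N → ℝ)
    (hu1 : Measurable u1) (hu2 : Measurable u2)
    (hv1 : Measurable v1) (hv2 : Measurable v2)
    (hu10 : VanishesAtInfinity u1) (hu20 : VanishesAtInfinity u2)
    (hv10 : VanishesAtInfinity v1) (hv20 : VanishesAtInfinity v2) :
    ∫⁻ x : EucN N,
        (ENNReal.ofReal (|u1 x| ^ r1 * |u2 x| ^ r2) +
          ENNReal.ofReal (|v1 x| ^ r1 * |v2 x| ^ r2)) ≤
      ∫⁻ x : EucN N,
        (shibata (fun y => |u1 y|) (fun y => |v1 y|) x) ^ r1 *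
          (shibata (fun y => |u2 y|) (fun y => |v2 y|) x) ^ r2 := by
  have h1 : 0 < r1 := by linarith
  have h2 : 0 < r2 := by linarith
  have hw (r : ℝ) : Measurable fun s : ℝ => ENNReal.ofReal (r * s ^ (r - 1)) := by fun_prop
  have hlevel {w : EucN N → ℝ} (hw : Measurable w) :
      MeasurableSet {p : ℝ × EucN N | p.2 ∈ {y | p.1 < |w y|}} :=
    measurableSet_lt measurable_fst (by fun_prop)
  have hlayers {f g : EucN N → ℝ} (hf : Measurable f) (hg : Measurable g) :
      ∫⁻ x, ENNReal.ofReal (|f x| ^ r1 * |g x| ^ r2) =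
        ∫⁻ s in Set.Ioi 0, ∫⁻ t in Set.Ioi 0,
          ENNReal.ofReal (r1 * s ^ (r1 - 1)) * ENNReal.ofReal (r2 * t ^ (r2 - 1)) *
            volume ({y | s < |f y|} ∩ {y | t < |g y|}) := by
    rw [← lintegral_mul_layers _ _ (hw r1) (hw r2) (hlevel hf) (hlevel hg)]
    refine lintegral_congr fun x => ?_
    rw [ENNReal.ofReal_mul (by positivity), ofReal_abs_rpow_eq_layers f h1,
      ofReal_abs_rpow_eq_layers g h2]
  have hmeas {f g : EucN N → ℝ} (hf : Measurable f) (hg : Measurable g) :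
      Measurable fun p : ℝ × ℝ =>
        ENNReal.ofReal (r1 * p.1 ^ (r1 - 1)) * ENNReal.ofReal (r2 * p.2 ^ (r2 - 1)) *
          volume ({y | p.1 < |f y|} ∩ {y | p.2 < |g y|}) := by
    refine (((hw r1).comp measurable_fst).mul ((hw r2).comp measurable_snd)).mul ?_
    have hset : MeasurableSet
        ({q : (ℝ × ℝ) × EucN N | q.1.1 < |f q.2|} ∩ {q | q.1.2 < |g q.2|}) :=
      (measurableSet_lt (by fun_prop) (by fun_prop)).inter
        (measurableSet_lt (by fun_prop) (by fun_prop))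
    exact measurable_measure_prodMk_left hset
  rw [lintegral_add_left (by fun_prop), hlayers hu1 hu2, hlayers hv1 hv2,
    ← lintegral_add_left (hmeas hu1 hu2).lintegral_prod_right']
  refine le_trans ?_ (lintegral_mono fun x => mul_le_mul'
    (layers_Astar_le_shibata_rpow _ _ h1 x) (layers_Astar_le_shibata_rpow _ _ h2 x))
  rw [lintegral_mul_layers _ _ (hw r1) (hw r2) (measurableSet_uncurry_Astar _ _)
    (measurableSet_uncurry_Astar _ _)]
  refine setLIntegral_mono' measurableSet_Ioi fun s hs => ?_
  have hmeas_s := (hmeas hu1 hu2).comp (measurable_prodMk_left (x := s))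
  simp only [Function.comp_def] at hmeas_s
  rw [← lintegral_add_left hmeas_s]
  refine lintegral_mono fun t => ?_
  simp only [← mul_add]
  gcongr
  exact volume_inter_add_volume_inter_le_Astar hN hu10 hv10 hs t
end
end

section
/- Let N ≥ 1 and let p be a real number with p > 1, and additionally p ≤ N/(N−2) when N ≥ 3. Let u : ℝ^N → ℝ be a smooth (infinitely differentiable) nonnegative function such that ∫_{ℝ^N} u(x)^p dx < ∞ and such that Δu(x) ≤ 0 for every x ∈ ℝ^N (i.e. −Δu ≥ 0 in ℝ^N). Then u is identically zero. -/
open MeasureTheory ENNReal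

noncomputable section

/-- The Laplacian `Δu(x) = Σᵢ D²u(x)(eᵢ, eᵢ)`, via the second iterated Fréchet derivative. -/
def laplacian {N : ℕ} (u : EucN N → ℝ) (x : EucN N) : ℝ :=
  ∑ i : Fin N, iteratedFDeriv ℝ 2 u x
    ![EuclideanSpace.single i (1 : ℝ), EuclideanSpace.single i (1 : ℝ)]

open Set Filter Topology

section Laplacian

variable {N : ℕ}

theorem laplacian_eq_sum_fderiv_fderiv {v : EucN N → ℝ} (hv : ContDiff ℝ 2 v) (x : EucN N) :
    laplacian v x = ∑ i : Fin N,
      fderiv ℝ (fun y => fderiv ℝ v y (EuclideanSpace.single i (1 : ℝ))) x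
        (EuclideanSpace.single i (1 : ℝ)) := by
  unfold laplacian
  refine Finset.sum_congr rfl fun i _ => ?_
  rw [iteratedFDeriv_two_apply, fderiv_clm_apply
    ((hv.fderiv_right (m := 1) (by norm_num)).differentiable (by norm_num) x)
    (differentiableAt_const _)]
  simp

theorem continuous_laplacian {v : EucN N → ℝ} (hv : ContDiff ℝ 2 v) :
    Continuous (laplacian v) := by
  have h := hv.continuous_iteratedFDeriv (m := 2) le_rfl
  unfold laplacian
  fun_prop

theorem HasCompactSupport.laplacian {v : EucN N → ℝ} (hv : HasCompactSupport v) :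
    HasCompactSupport (laplacian v) := by
  refine (hv.iteratedFDeriv (𝕜 := ℝ) 2).mono fun x hx => ?_
  contrapose! hx
  simp only [Function.mem_support, not_not] at hx ⊢
  simp [_root_.laplacian, hx]

theorem laplacian_comp_smul {v : EucN N → ℝ} (hv : ContDiff ℝ 2 v) (a : ℝ) (x : EucN N) :
    laplacian (fun y => v (a • y)) x = a ^ 2 * laplacian v (a • x) := by
  unfold laplacian
  rw [iteratedFDeriv_comp_const_smul (i := 2) a hv]
  simp [Finset.mul_sum]

theorem laplacian_eq_zero_of_eventuallyEq_one {v : EucN N → ℝ} {x : EucN N}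
    (h : v =ᶠ[𝓝 x] 1) : laplacian v x = 0 := by
  have h' := (h.iteratedFDeriv (𝕜 := ℝ) 2).eq_of_nhds
  unfold laplacian
  rw [h', Pi.one_def]
  simp [iteratedFDeriv_const_of_ne]

/-- Green's second identity on `ℝ^N` against a compactly supported function. -/
theorem integral_laplacian_mul {v φ : EucN N → ℝ} (hv : ContDiff ℝ 2 v) (hφ : ContDiff ℝ 2 φ)
    (hc : HasCompactSupport φ) :
    ∫ x, laplacian v x * φ x = ∫ x, v x * laplacian φ x := by
  have hv1 : ∀ e : EucN N, ContDiff ℝ 1 (fun y => fderiv ℝ v y e) := fun e =>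
    (hv.fderiv_right (m := 1) (by norm_num)).clm_apply contDiff_const
  have hφ1 : ∀ e : EucN N, ContDiff ℝ 1 (fun y => fderiv ℝ φ y e) := fun e =>
    (hφ.fderiv_right (m := 1) (by norm_num)).clm_apply contDiff_const
  have hv2 : ∀ e : EucN N, Continuous (fun x => fderiv ℝ (fun y => fderiv ℝ v y e) x e) :=
    fun e => ((hv1 e).continuous_fderiv (by norm_num)).clm_apply continuous_const
  have hφ2 : ∀ e : EucN N, Continuous (fun x => fderiv ℝ (fun y => fderiv ℝ φ y e) x e) :=
    fun e => ((hφ1 e).continuous_fderiv (by norm_num)).clm_apply continuous_const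
  have hc1 : ∀ e : EucN N, HasCompactSupport (fun y => fderiv ℝ φ y e) := fun e =>
    hc.fderiv_apply (𝕜 := ℝ) e
  have hc2 : ∀ e : EucN N,
      HasCompactSupport (fun x => fderiv ℝ (fun y => fderiv ℝ φ y e) x e) := fun e =>
    (hc1 e).fderiv_apply (𝕜 := ℝ) e
  have i1 : ∀ e : EucN N,
      Integrable (fun x => fderiv ℝ (fun y => fderiv ℝ v y e) x e * φ x) := fun e =>
    ((hv2 e).mul hφ.continuous).integrable_of_hasCompactSupport hc.mul_left
  have i2 : ∀ e : EucN N, Integrable (fun x => fderiv ℝ v x e * fderiv ℝ φ x e) := fun e =>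
    ((hv1 e).continuous.mul (hφ1 e).continuous).integrable_of_hasCompactSupport (hc1 e).mul_left
  have i3 : ∀ e : EucN N,
      Integrable (fun x => v x * fderiv ℝ (fun y => fderiv ℝ φ y e) x e) := fun e =>
    (hv.continuous.mul (hφ2 e)).integrable_of_hasCompactSupport (hc2 e).mul_left
  have i4 : ∀ e : EucN N, Integrable (fun x => fderiv ℝ v x e * φ x) := fun e =>
    ((hv1 e).continuous.mul hφ.continuous).integrable_of_hasCompactSupport hc.mul_left
  have i5 : ∀ e : EucN N, Integrable (fun x => v x * fderiv ℝ φ x e) := fun e =>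
    (hv.continuous.mul (hφ1 e).continuous).integrable_of_hasCompactSupport (hc1 e).mul_left
  simp_rw [laplacian_eq_sum_fderiv_fderiv hv, laplacian_eq_sum_fderiv_fderiv hφ,
    Finset.sum_mul, Finset.mul_sum]
  rw [integral_finsetSum _ fun i _ => i1 _, integral_finsetSum _ fun i _ => i3 _]
  refine Finset.sum_congr rfl fun i _ => ?_
  have h1 := integral_mul_fderiv_eq_neg_fderiv_mul_of_integrable (i1 (EuclideanSpace.single i 1))
    (i2 _) (i4 _) (fun x _ => (hv1 _).differentiable (by norm_num) x)
    (fun x _ => hφ.differentiable (by norm_num) x)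
  have h2 := integral_mul_fderiv_eq_neg_fderiv_mul_of_integrable (i2 (EuclideanSpace.single i 1))
    (i3 _) (i5 _) (fun x _ => hv.differentiable (by norm_num) x)
    (fun x _ => (hφ1 _).differentiable (by norm_num) x)
  rw [h2, h1, neg_neg]

theorem laplacian_one_sub_exp_neg {u : EucN N → ℝ} (hu : ContDiff ℝ 2 u) (x : EucN N) :
    laplacian (fun y => 1 - Real.exp (-u y)) x = Real.exp (-u x) *
      (laplacian u x - ∑ i : Fin N, fderiv ℝ u x (EuclideanSpace.single i 1) ^ 2) := by
  have hd : Differentiable ℝ u := hu.differentiable (by norm_num)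
  have hE : ∀ y, HasFDerivAt (fun y => Real.exp (-u y)) (Real.exp (-u y) • -fderiv ℝ u y) y :=
    fun y => (hd y).hasFDerivAt.neg.exp
  have h1 : ∀ e : EucN N, (fun y => fderiv ℝ (fun y => 1 - Real.exp (-u y)) y e) =
      fun y => Real.exp (-u y) * fderiv ℝ u y e := fun e => by
    ext y
    rw [((hE y).const_sub 1).fderiv]
    simp
  rw [laplacian_eq_sum_fderiv_fderiv (by fun_prop), laplacian_eq_sum_fderiv_fderiv hu,
    ← Finset.sum_sub_distrib, Finset.mul_sum]
  refine Finset.sum_congr rfl fun i _ => ?_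
  have h2 : Differentiable ℝ (fun y => fderiv ℝ u y (EuclideanSpace.single i (1 : ℝ))) :=
    ((hu.fderiv_right (m := 1) (by norm_num)).clm_apply contDiff_const).differentiable
      (by norm_num)
  rw [h1, ((hE x).fun_mul (h2 x).hasFDerivAt).fderiv]
  simp
  ring

/-- The scaled test functions `φ(x / R)` have Laplacians bounded in `L^q` when `N ≤ 2 q`. -/
theorem integral_abs_laplacian_comp_inv_smul_rpow_le {φ : EucN N → ℝ} (hφ : ContDiff ℝ 2 φ)
    {q R : ℝ} (hq : (N : ℝ) ≤ 2 * q) (hR : 1 ≤ R) :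
    ∫ x, |laplacian (fun y => φ (R⁻¹ • y)) x| ^ q ≤ ∫ x, |laplacian φ x| ^ q := by
  have hR0 : 0 < R := by linarith
  have hC : 0 ≤ ∫ x, |laplacian φ x| ^ q := integral_nonneg fun x => by positivity
  have h1 : ∀ x, |laplacian (fun y => φ (R⁻¹ • y)) x| ^ q =
      R ^ (-(2 * q)) * |laplacian φ (R⁻¹ • x)| ^ q := fun x => by
    rw [laplacian_comp_smul hφ, abs_mul, Real.mul_rpow (abs_nonneg _) (abs_nonneg _),
      abs_of_nonneg (by positivity : (0 : ℝ) ≤ R⁻¹ ^ 2), ← Real.rpow_natCast,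
      ← Real.rpow_mul (by positivity), Real.inv_rpow hR0.le, Real.rpow_neg hR0.le]
    norm_num
  simp_rw [h1]
  rw [integral_const_mul,
    Measure.integral_comp_inv_smul_of_nonneg volume (fun x => |laplacian φ x| ^ q) hR0.le,
    finrank_euclideanSpace_fin, smul_eq_mul, ← mul_assoc, ← Real.rpow_natCast,
    ← Real.rpow_add hR0]
  exact mul_le_of_le_one_left hC (Real.rpow_le_one_of_one_le_of_nonpos hR (by linarith))

/-- A nonnegative superharmonic function in `L^p(ℝ^N)` is harmonic if the conjugate exponent `q`
satisfies `N ≤ 2 q`. -/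
theorem laplacian_eq_zero_of_superharmonic {v : EucN N → ℝ} (hv : ContDiff ℝ 2 v)
    (hpos : ∀ x, 0 ≤ v x) (hsuper : ∀ x, laplacian v x ≤ 0) {p q : ℝ}
    (hpq : p.HolderConjugate q) (hq : (N : ℝ) ≤ 2 * q)
    (hint : Integrable fun x => v x ^ p) (x₀ : EucN N) : laplacian v x₀ = 0 := by
  let φ : ContDiffBump (0 : EucN N) := ⟨1, 2, by norm_num, by norm_num⟩
  let ψ : ContDiffBump x₀ := ⟨1, 2, by norm_num, by norm_num⟩
  let R : ℕ → ℝ := fun n => n + 1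
  have hR : ∀ n, 1 ≤ R n := fun n => by simp [R]
  let φs : ℕ → EucN N → ℝ := fun n x => φ ((R n)⁻¹ • x)
  have hφ : ContDiff ℝ 2 φ := φ.contDiff
  have hφs : ∀ n, ContDiff ℝ 2 (φs n) := fun n => hφ.comp (contDiff_const_smul _)
  have hφc : ∀ n, HasCompactSupport (φs n) := fun n =>
    φ.hasCompactSupport.comp_smul (inv_ne_zero (by linarith [hR n]))
  have hlap : Continuous (laplacian v) := continuous_laplacian hv
  let S : ℕ → Set (EucN N) := fun n => {x | R n ≤ ‖x‖}
  have hS : ∀ n, MeasurableSet (S n) := fun n => measurableSet_le measurable_const measurable_norm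
  have hnear : ∀ n x, x ∉ S n → φs n =ᶠ[𝓝 x] 1 := fun n x hx => by
    have hx : ‖x‖ < R n := not_le.1 hx
    have hx' : (R n)⁻¹ • x ∈ Metric.ball (0 : EucN N) φ.rIn := by
      have hRn : 0 < R n := by linarith [hR n]
      rw [mem_ball_zero_iff, norm_smul, norm_inv, Real.norm_of_nonneg hRn.le]
      change (R n)⁻¹ * ‖x‖ < 1
      rwa [inv_mul_lt_iff₀ hRn, mul_one]
    exact (continuous_const_smul (R n)⁻¹).continuousAt.eventually
      (φ.eventuallyEq_one_of_mem_ball hx')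
  let C : ℝ := ∫ x, |laplacian φ x| ^ q
  let T : ℕ → ℝ := fun n => ∫ x in S n, v x ^ p
  have hT : Tendsto T atTop (𝓝 0) := by
    have h := tendsto_setIntegral_of_antitone (μ := volume) (f := fun x => v x ^ p) hS
      (fun m n hmn x (hx : R n ≤ ‖x‖) =>
        show R m ≤ ‖x‖ from le_trans (by simpa [R] using hmn) hx) ⟨0, hint.integrableOn⟩
    have hempty : ⋂ n, S n = ∅ := by
      ext x
      obtain ⟨n, hn⟩ := exists_nat_gt ‖x‖
      simp only [mem_iInter, mem_empty_iff_false, iff_false, not_forall]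
      exact ⟨n, not_le.2 (show ‖x‖ < (n : ℝ) + 1 by linarith)⟩
    simpa [hempty] using h
  have hbound : ∀ n, ∫ x, -laplacian v x * φs n x ≤ T n ^ (1 / p) * C ^ (1 / q) := fun n => by
    have hLc : Continuous (laplacian (φs n)) := continuous_laplacian (hφs n)
    have hLs : HasCompactSupport (laplacian (φs n)) := (hφc n).laplacian
    have hind : ∀ x, (S n).indicator v x ^ p = (S n).indicator (fun x => v x ^ p) x := fun x => by
      by_cases hx : x ∈ S n <;> simp [hx, Real.zero_rpow hpq.ne_zero]
    have hind0 : ∀ x, 0 ≤ (S n).indicator v x := fun x => indicator_nonneg (fun x _ => hpos x) x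
    have hmem : MemLp ((S n).indicator v) (ENNReal.ofReal p) := by
      rw [← integrable_norm_rpow_iff (hv.continuous.aestronglyMeasurable.indicator (hS n))
        (by simpa using hpq.pos) ENNReal.ofReal_ne_top, ENNReal.toReal_ofReal hpq.nonneg]
      simp_rw [Real.norm_of_nonneg (hind0 _), hind]
      exact hint.indicator (hS n)
    have hmem' : MemLp (fun x => |laplacian (φs n) x|) (ENNReal.ofReal q) :=
      (hLc.memLp_of_hasCompactSupport hLs).norm
    calc ∫ x, -laplacian v x * φs n x = ∫ x, -(v x * laplacian (φs n) x) := by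
          simp_rw [neg_mul]
          rw [integral_neg, integral_neg, integral_laplacian_mul hv (hφs n) (hφc n)]
      _ ≤ ∫ x, (S n).indicator v x * |laplacian (φs n) x| := by
          refine integral_mono
            ((hv.continuous.mul hLc).integrable_of_hasCompactSupport hLs.mul_left).neg ?_ ?_
          · refine (((hv.continuous.mul hLc.abs).integrable_of_hasCompactSupport
              (hLs.abs.mul_left)).indicator (hS n)).congr (ae_of_all _ fun x => ?_)
            by_cases hx : x ∈ S n <;> simp [hx]
          · intro x
            by_cases hx : x ∈ S n
            · simp only [indicator_of_mem hx]
              rw [← mul_neg]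
              exact mul_le_mul_of_nonneg_left (neg_le_abs _) (hpos x)
            · simp [hx, laplacian_eq_zero_of_eventuallyEq_one (hnear n x hx)]
      _ ≤ (∫ x, (S n).indicator v x ^ p) ^ (1 / p) *
            (∫ x, |laplacian (φs n) x| ^ q) ^ (1 / q) :=
          integral_mul_le_Lp_mul_Lq_of_nonneg hpq (ae_of_all _ hind0)
            (ae_of_all _ fun x => abs_nonneg _) hmem hmem'
      _ ≤ T n ^ (1 / p) * C ^ (1 / q) := by
          simp_rw [hind]
          rw [integral_indicator (hS n)]
          gcongr
          · exact Real.rpow_nonneg (integral_nonneg fun x => Real.rpow_nonneg (hpos x) p) _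
          · exact one_div_nonneg.2 hpq.symm.nonneg
          · exact integral_abs_laplacian_comp_inv_smul_rpow_le hφ hq (hR n)
  have hlim : Tendsto (fun n => T n ^ (1 / p) * C ^ (1 / q)) atTop (𝓝 0) := by
    have h := (hT.rpow_const (p := 1 / p) (Or.inr (one_div_nonneg.2 hpq.nonneg))).mul_const
      (C ^ (1 / q))
    rwa [Real.zero_rpow (one_div_ne_zero hpq.ne_zero), zero_mul] at h
  have hψi : Continuous fun x => -laplacian v x * ψ x := hlap.neg.mul ψ.continuous
  have hψc : HasCompactSupport fun x => -laplacian v x * ψ x := ψ.hasCompactSupport.mul_left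
  have hle : ∫ x, -laplacian v x * ψ x ≤ 0 := by
    refine ge_of_tendsto hlim ?_
    obtain ⟨m, hm⟩ := exists_nat_gt (‖x₀‖ + 2)
    filter_upwards [eventually_ge_atTop m] with n hn
    refine le_trans (integral_mono (hψi.integrable_of_hasCompactSupport hψc)
      ((hlap.neg.mul (hφs n).continuous).integrable_of_hasCompactSupport (hφc n).mul_left)
      fun x => ?_) (hbound n)
    refine mul_le_mul_of_nonneg_left ?_ (neg_nonneg.2 (hsuper x))
    by_cases hx : x ∈ S n
    · rw [ψ.zero_of_le_dist]
      · exact φ.nonneg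
      · have hn' : (m : ℝ) ≤ n := by exact_mod_cast hn
        have hx' : (n : ℝ) + 1 ≤ ‖x‖ := hx
        have := norm_sub_norm_le x x₀
        rw [dist_eq_norm]
        change (2 : ℝ) ≤ _
        linarith
    · rw [(hnear n x hx).eq_of_nhds]
      exact ψ.le_one
  by_contra hne
  refine hle.not_gt (hψi.integral_pos_of_hasCompactSupport_nonneg_nonzero (x := x₀) hψc
    (fun x => mul_nonneg (neg_nonneg.2 (hsuper x)) ψ.nonneg) ?_)
  rw [ψ.eventuallyEq_one.eq_of_nhds]
  simpa using hne

end Laplacian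

/-- Liouville-type theorem (Lemma 2.3 of the paper): a smooth nonnegative superharmonic
function in `L^p(ℝ^N)` with `1 < p`, and `p ≤ N/(N-2)` when `N ≥ 3`, vanishes identically. -/
theorem liouville_superharmonic
    (N : ℕ) (hN : 1 ≤ N) (p : ℝ) (hp : 1 < p)
    (hp' : 3 ≤ N → p ≤ (N : ℝ) / ((N : ℝ) - 2))
    (u : EucN N → ℝ) (hsmooth : ContDiff ℝ (⊤ : ℕ∞) u) (hpos : ∀ x, 0 ≤ u x)
    (hint : ∫⁻ x : EucN N, ENNReal.ofReal (u x ^ p) < ⊤)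
    (hsuper : ∀ x : EucN N, laplacian u x ≤ 0) :
    ∀ x : EucN N, u x = 0 := by
  have hu : ContDiff ℝ 2 u := contDiff_infty.1 hsmooth 2
  have hpq : p.HolderConjugate p.conjExponent := Real.HolderConjugate.conjExponent hp
  have hq : (N : ℝ) ≤ 2 * p.conjExponent := by
    rw [Real.conjExponent, ← mul_div_assoc, le_div_iff₀ (by linarith)]
    rcases le_or_gt 3 N with h3 | h3
    · have h3' : (3 : ℝ) ≤ N := by exact_mod_cast h3
      have := (le_div_iff₀ (by linarith)).1 (hp' h3)
      linarith
    · have h3' : (N : ℝ) ≤ 2 := by exact_mod_cast Nat.lt_succ_iff.1 h3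
      nlinarith
  let v : EucN N → ℝ := fun x => 1 - Real.exp (-u x)
  have hv : ContDiff ℝ 2 v := by fun_prop
  have hv0 : ∀ x, 0 ≤ v x := fun x => by simpa [v] using hpos x
  have hvu : ∀ x, v x ≤ u x := fun x => by
    have := Real.add_one_le_exp (-u x)
    simp only [v]
    linarith
  have huint : Integrable fun x => u x ^ p := by
    refine ⟨(hu.continuous.rpow_const fun x => Or.inr hpq.nonneg).aestronglyMeasurable, ?_⟩
    rwa [hasFiniteIntegral_iff_ofReal (ae_of_all _ fun x => Real.rpow_nonneg (hpos x) p)]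
  have hvint : Integrable fun x => v x ^ p := by
    refine huint.mono'
      (hv.continuous.rpow_const fun x => Or.inr hpq.nonneg).aestronglyMeasurable
      (ae_of_all _ fun x => ?_)
    rw [Real.norm_of_nonneg (Real.rpow_nonneg (hv0 x) p)]
    exact Real.rpow_le_rpow (hv0 x) (hvu x) hpq.nonneg
  have hsq : ∀ x, 0 ≤ ∑ i : Fin N, fderiv ℝ u x (EuclideanSpace.single i 1) ^ 2 := fun x =>
    Finset.sum_nonneg fun i _ => sq_nonneg _
  have hvsuper : ∀ x, laplacian v x ≤ 0 := fun x => by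
    rw [laplacian_one_sub_exp_neg hu]
    exact mul_nonpos_of_nonneg_of_nonpos (Real.exp_pos _).le (by linarith [hsuper x, hsq x])
  have hgrad : ∀ x, fderiv ℝ u x = 0 := fun x => by
    have h := laplacian_eq_zero_of_superharmonic hv hv0 hvsuper hpq hq hvint x
    rw [laplacian_one_sub_exp_neg hu, mul_eq_zero, or_iff_right (Real.exp_pos _).ne'] at h
    have h0 : ∑ i : Fin N, fderiv ℝ u x (EuclideanSpace.single i 1) ^ 2 = 0 := by
      linarith [hsuper x, hsq x]
    rw [Finset.sum_eq_zero_iff_of_nonneg fun i _ => sq_nonneg _] at h0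
    refine ContinuousLinearMap.coe_injective
      ((EuclideanSpace.basisFun (Fin N) ℝ).toBasis.ext fun i => ?_)
    simpa using h0 i (Finset.mem_univ i)
  intro x
  by_contra hx
  have hconst : ∀ y, u y = u x := fun y =>
    is_const_of_fderiv_eq_zero (hu.differentiable (by norm_num)) hgrad y x
  have : NeZero N := ⟨by omega⟩
  have : NoncompactSpace (EucN N) := NormedSpace.noncompactSpace ℝ (EucN N)
  have hup : 0 < u x ^ p := Real.rpow_pos_of_pos (lt_of_le_of_ne (hpos x) (Ne.symm hx)) p
  simp_rw [hconst, lintegral_const, measure_univ_of_isAddLeftInvariant] at hint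
  rw [ENNReal.mul_top (by simpa using hup)] at hint
  exact lt_irrefl _ hint
end
end

section
/- Let N ≥ 1 and let r1, r2 > 1 be real numbers with r1 + r2 ≤ 2*, where 2* := 2N/(N−2) if N ≥ 3 and 2* := ∞ if N ≤ 2. Let u_n, v_n (n ∈ ℕ) and u, v be measurable real-valued functions on ℝ^N such that u_n → u almost everywhere, v_n → v almost everywhere, and sup_n ∫_{ℝ^N} (|u_n(x)|^{r1+r2} + |v_n(x)|^{r1+r2}) dx < ∞. Then ∫_{ℝ^N} (|u_n(x)|^{r1}|v_n(x)|^{r2} − |u_n(x) − u(x)|^{r1}|v_n(x) − v(x)|^{r2}) dx converges to ∫_{ℝ^N} |u(x)|^{r1}|v(x)|^{r2} dx as n → ∞. -/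
open MeasureTheory ENNReal Filter

noncomputable section

open scoped Topology NNReal

section HomogeneousFunctions

variable {E : Type*} [NormedAddCommGroup E] [NormedSpace ℝ E] [ProperSpace E]
  {F : E → ℝ} {p : ℝ}

theorem exists_abs_le_mul_norm_rpow_of_homogeneous (hF : Continuous F) (hp : 0 < p)
    (hom : ∀ t : ℝ, 0 ≤ t → ∀ z, F (t • z) = t ^ p * F z) :
    ∃ M : ℝ, 0 ≤ M ∧ ∀ z, |F z| ≤ M * ‖z‖ ^ p := by
  obtain ⟨M, hM⟩ := (isCompact_closedBall (0 : E) 1).exists_bound_of_continuousOn hF.continuousOn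
  have hM0 : 0 ≤ M := (norm_nonneg _).trans (hM 0 (by simp))
  refine ⟨M, hM0, fun z => ?_⟩
  rcases eq_or_ne z 0 with rfl | hz
  · have h0 := hom 0 le_rfl 0
    rw [Real.zero_rpow hp.ne', zero_mul, zero_smul] at h0
    simp [h0, Real.zero_rpow hp.ne']
  · have hz' : 0 < ‖z‖ := norm_pos_iff.2 hz
    have h1 := hom ‖z‖ hz'.le (‖z‖⁻¹ • z)
    rw [smul_inv_smul₀ hz'.ne'] at h1
    have h2 : |F (‖z‖⁻¹ • z)| ≤ M :=
      hM _ (by simp [norm_smul, hz'.ne'])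
    rw [h1, abs_mul, abs_of_nonneg (by positivity), mul_comm]
    gcongr

theorem exists_abs_add_sub_le_of_homogeneous (hF : Continuous F) (hp : 0 < p)
    (hom : ∀ t : ℝ, 0 ≤ t → ∀ z, F (t • z) = t ^ p * F z) {ε : ℝ} (hε : 0 < ε) :
    ∃ C : ℝ, 0 ≤ C ∧ ∀ z w, |F (z + w) - F z| ≤ ε * ‖z‖ ^ p + C * ‖w‖ ^ p := by
  obtain ⟨M, hM0, hM⟩ := exists_abs_le_mul_norm_rpow_of_homogeneous hF hp hom
  have huc := (isCompact_closedBall (0 : E) 2).uniformContinuousOn_of_continuous hF.continuousOn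
  obtain ⟨δ', hδ', hδF⟩ := Metric.uniformContinuousOn_iff_le.1 huc ε hε
  obtain ⟨δ, hδ, hδδ', hδ1⟩ : ∃ δ : ℝ, 0 < δ ∧ δ ≤ δ' ∧ δ ≤ 1 :=
    ⟨min δ' 1, by positivity, min_le_left _ _, min_le_right _ _⟩
  refine ⟨2 * M * (δ⁻¹ + 1) ^ p, by positivity, fun z w => ?_⟩
  by_cases hzw : ‖w‖ ≤ δ * ‖z‖ ∧ z ≠ 0
  · obtain ⟨hzw, hz⟩ := hzw
    have hz' : 0 < ‖z‖ := norm_pos_iff.2 hz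
    have h1 := hom ‖z‖ hz'.le (‖z‖⁻¹ • z)
    have h2 := hom ‖z‖ hz'.le (‖z‖⁻¹ • (z + w))
    rw [smul_inv_smul₀ hz'.ne'] at h1 h2
    have hzn : ‖‖z‖⁻¹ • z‖ = 1 := by simp [norm_smul, hz'.ne']
    have hwn : ‖‖z‖⁻¹ • w‖ ≤ δ := by
      rw [norm_smul, norm_inv, norm_norm, inv_mul_le_iff₀ hz', mul_comm]
      exact hzw
    have h3 : |F (‖z‖⁻¹ • (z + w)) - F (‖z‖⁻¹ • z)| ≤ ε := by
      refine hδF _ ?_ _ ?_ ?_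
      · rw [mem_closedBall_zero_iff, smul_add]
        linarith [norm_add_le (‖z‖⁻¹ • z) (‖z‖⁻¹ • w)]
      · rw [mem_closedBall_zero_iff]
        linarith
      · rw [dist_eq_norm, smul_add, add_sub_cancel_left]
        exact hwn.trans hδδ'
    rw [h1, h2, ← mul_sub, abs_mul, abs_of_nonneg (by positivity), mul_comm]
    have h4 : 0 ≤ 2 * M * (δ⁻¹ + 1) ^ p * ‖w‖ ^ p := by positivity
    have h5 := mul_le_mul_of_nonneg_right h3 (Real.rpow_nonneg hz'.le p)
    linarith
  · have hz : ‖z‖ ≤ δ⁻¹ * ‖w‖ := by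
      rw [le_inv_mul_iff₀ hδ]
      by_contra! h
      refine hzw ⟨h.le, ?_⟩
      rintro rfl
      rw [norm_zero, mul_zero] at h
      exact (norm_nonneg w).not_gt h
    have h1 : ‖z + w‖ ≤ (δ⁻¹ + 1) * ‖w‖ := by linarith [norm_add_le z w]
    have h2 : ‖z‖ ≤ (δ⁻¹ + 1) * ‖w‖ := by linarith [norm_nonneg w]
    have key : ∀ y : E, ‖y‖ ≤ (δ⁻¹ + 1) * ‖w‖ → |F y| ≤ M * ((δ⁻¹ + 1) ^ p * ‖w‖ ^ p) := by
      intro y hy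
      rw [← Real.mul_rpow (by positivity) (norm_nonneg w)]
      refine (hM y).trans ?_
      gcongr
    have h3 : 0 ≤ ε * ‖z‖ ^ p := by positivity
    linarith [abs_sub (F (z + w)) (F z), key _ h1, key _ h2]

theorem exists_enorm_add_sub_sub_le_of_homogeneous (hF : Continuous F) (hp : 0 < p)
    (hom : ∀ t : ℝ, 0 ≤ t → ∀ z, F (t • z) = t ^ p * F z) {ε : ℝ≥0} (hε : 0 < ε) :
    ∃ C : ℝ≥0, ∀ z w, ‖F (z + w) - F z - F w‖ₑ ≤ ε * ‖z‖ₑ ^ p + C * ‖w‖ₑ ^ p := by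
  obtain ⟨M, hM0, hM⟩ := exists_abs_le_mul_norm_rpow_of_homogeneous hF hp hom
  obtain ⟨C, hC0, hC⟩ := exists_abs_add_sub_le_of_homogeneous hF hp hom (NNReal.coe_pos.2 hε)
  lift C to ℝ≥0 using hC0
  lift M to ℝ≥0 using hM0
  refine ⟨C + M, fun z w => ?_⟩
  rw [enorm_eq_nnnorm, enorm_eq_nnnorm, enorm_eq_nnnorm, ← ENNReal.coe_rpow_of_nonneg _ hp.le,
    ← ENNReal.coe_rpow_of_nonneg _ hp.le]
  norm_cast
  rw [← NNReal.coe_le_coe]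
  push_cast
  rw [Real.norm_eq_abs]
  linarith [abs_sub (F (z + w) - F z) (F w), hC z w, hM w]

end HomogeneousFunctions

theorem ENNReal.add_rpow_le_two_rpow_mul {p : ℝ} (hp : 0 ≤ p) (a b : ℝ≥0∞) :
    (a + b) ^ p ≤ 2 ^ p * (a ^ p + b ^ p) := by
  wlog h : a ≤ b generalizing a b
  · rw [add_comm a, add_comm (a ^ p)]
    exact this b a (le_of_not_ge h)
  calc (a + b) ^ p ≤ (2 * b) ^ p := by rw [two_mul]; gcongr
    _ = 2 ^ p * b ^ p := ENNReal.mul_rpow_of_nonneg _ _ hp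
    _ ≤ 2 ^ p * (a ^ p + b ^ p) := by gcongr; exact le_add_self

section BrezisLieb

variable {α : Type*} [MeasurableSpace α] {μ : Measure α}
  {E : Type*} [NormedAddCommGroup E] {f : ℕ → α → E} {g : α → E} {p : ℝ} {K : ℝ≥0∞}

theorem lintegral_enorm_rpow_le_of_tendsto_ae
    (hf : ∀ n, AEStronglyMeasurable (f n) μ)
    (hlim : ∀ᵐ x ∂μ, Tendsto (fun n => f n x) atTop (𝓝 (g x)))
    (hK : ∀ n, ∫⁻ x, ‖f n x‖ₑ ^ p ∂μ ≤ K) : ∫⁻ x, ‖g x‖ₑ ^ p ∂μ ≤ K := by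
  calc ∫⁻ x, ‖g x‖ₑ ^ p ∂μ = ∫⁻ x, liminf (fun n => ‖f n x‖ₑ ^ p) atTop ∂μ := by
        refine lintegral_congr_ae ?_
        filter_upwards [hlim] with x hx
        exact (((ENNReal.continuous_rpow_const (y := p)).tendsto _).comp hx.enorm).liminf_eq.symm
    _ ≤ liminf (fun n => ∫⁻ x, ‖f n x‖ₑ ^ p ∂μ) atTop :=
        lintegral_liminf_le' fun n => (hf n).enorm.pow_const p
    _ ≤ K := liminf_le_of_le (by isBoundedDefault) fun b hb => by
        obtain ⟨n, hn⟩ := hb.exists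
        exact hn.trans (hK n)

variable [NormedSpace ℝ E] [ProperSpace E] {F : E → ℝ}

theorem tendsto_lintegral_brezis_lieb_of_homogeneous (hF : Continuous F) (hp : 0 < p)
    (hom : ∀ t : ℝ, 0 ≤ t → ∀ z, F (t • z) = t ^ p * F z)
    (hf : ∀ n, AEStronglyMeasurable (f n) μ) (hg : AEStronglyMeasurable g μ)
    (hlim : ∀ᵐ x ∂μ, Tendsto (fun n => f n x) atTop (𝓝 (g x)))
    (hKtop : K ≠ ⊤) (hK : ∀ n, ∫⁻ x, ‖f n x‖ₑ ^ p ∂μ ≤ K) :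
    Tendsto (fun n => ∫⁻ x, ‖F (f n x) - F (f n x - g x) - F (g x)‖ₑ ∂μ) atTop (𝓝 0) := by
  have hgK := lintegral_enorm_rpow_le_of_tendsto_ae hf hlim hK
  have hdm : ∀ n, AEStronglyMeasurable (fun x => f n x - g x) μ := fun n => (hf n).sub hg
  have hdK : ∀ n, ∫⁻ x, ‖f n x - g x‖ₑ ^ p ∂μ ≤ 2 ^ p * (K + K) := fun n => by
    calc ∫⁻ x, ‖f n x - g x‖ₑ ^ p ∂μ
        ≤ ∫⁻ x, 2 ^ p * (‖f n x‖ₑ ^ p + ‖g x‖ₑ ^ p) ∂μ := by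
          refine lintegral_mono fun x => le_trans ?_ (ENNReal.add_rpow_le_two_rpow_mul hp.le _ _)
          gcongr
          exact enorm_sub_le
      _ = 2 ^ p * (∫⁻ x, ‖f n x‖ₑ ^ p ∂μ + ∫⁻ x, ‖g x‖ₑ ^ p ∂μ) := by
          rw [lintegral_const_mul' _ _ (by finiteness),
            lintegral_add_left' ((hf n).enorm.pow_const p)]
      _ ≤ 2 ^ p * (K + K) := by gcongr; exact hK n
  rw [ENNReal.tendsto_nhds_zero]
  intro η hη
  obtain ⟨ε, hε, hεη⟩ := ENNReal.exists_nnreal_pos_mul_lt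
    (a := 2 ^ p * (K + K)) (b := η / 2) (by finiteness) (ENNReal.half_pos hη.ne').ne'
  obtain ⟨C, hC⟩ := exists_enorm_add_sub_sub_le_of_homogeneous hF hp hom hε
  have hWm : ∀ n, AEMeasurable (fun x => ‖F (f n x) - F (f n x - g x) - F (g x)‖ₑ) μ := fun n =>
    (((hF.comp_aestronglyMeasurable (hf n)).sub (hF.comp_aestronglyMeasurable (hdm n))).sub
      (hF.comp_aestronglyMeasurable hg)).enorm
  have hem : ∀ n, AEMeasurable (fun x => (ε : ℝ≥0∞) * ‖f n x - g x‖ₑ ^ p) μ := fun n =>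
    ((hdm n).enorm.pow_const p).const_mul _
  have hF0 : F 0 = 0 := by
    have h0 := hom 0 le_rfl 0
    rwa [Real.zero_rpow hp.ne', zero_mul, zero_smul] at h0
  have hdct : Tendsto (fun n => ∫⁻ x, (‖F (f n x) - F (f n x - g x) - F (g x)‖ₑ
      - ε * ‖f n x - g x‖ₑ ^ p) ∂μ) atTop (𝓝 (∫⁻ _, 0 ∂μ)) := by
    refine tendsto_lintegral_of_dominated_convergence' (fun x => C * ‖g x‖ₑ ^ p)
      (fun n => (hWm n).sub (hem n)) (fun n => ae_of_all _ fun x => ?_) ?_ ?_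
    · have h := hC (f n x - g x) (g x)
      rw [sub_add_cancel] at h
      exact tsub_le_iff_left.2 h
    · rw [lintegral_const_mul' _ _ (by finiteness)]
      exact ENNReal.mul_ne_top (by finiteness) (ne_top_of_le_ne_top hKtop hgK)
    · filter_upwards [hlim] with x hx
      have hd : Tendsto (fun n => f n x - g x) atTop (𝓝 0) := by
        simpa using hx.sub_const (g x)
      have hW : Tendsto (fun n => ‖F (f n x) - F (f n x - g x) - F (g x)‖ₑ) atTop (𝓝 0) := by
        simpa [hF0] using ((((hF.tendsto _).comp hx).sub ((hF.tendsto _).comp hd)).sub_const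
          (F (g x))).enorm
      exact tendsto_of_tendsto_of_tendsto_of_le_of_le tendsto_const_nhds hW
        (fun _ => zero_le) (fun _ => tsub_le_self)
  rw [lintegral_zero] at hdct
  filter_upwards [ENNReal.tendsto_nhds_zero.1 hdct (η / 2) (ENNReal.half_pos hη.ne')] with n hn
  calc ∫⁻ x, ‖F (f n x) - F (f n x - g x) - F (g x)‖ₑ ∂μ
      ≤ ∫⁻ x, ((‖F (f n x) - F (f n x - g x) - F (g x)‖ₑ - ε * ‖f n x - g x‖ₑ ^ p)
          + ε * ‖f n x - g x‖ₑ ^ p) ∂μ := lintegral_mono fun x => le_tsub_add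
    _ = ∫⁻ x, (‖F (f n x) - F (f n x - g x) - F (g x)‖ₑ - ε * ‖f n x - g x‖ₑ ^ p) ∂μ
          + ε * ∫⁻ x, ‖f n x - g x‖ₑ ^ p ∂μ := by
        rw [lintegral_add_right' _ (hem n), lintegral_const_mul' _ _ (by finiteness)]
    _ ≤ η / 2 + η / 2 := by
        gcongr
        exact (mul_le_mul_right (hdK n) _).trans hεη.le
    _ = η := ENNReal.add_halves η

theorem integrable_comp_of_homogeneous (hF : Continuous F) (hp : 0 < p)
    (hom : ∀ t : ℝ, 0 ≤ t → ∀ z, F (t • z) = t ^ p * F z)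
    (hg : AEStronglyMeasurable g μ) (hgp : ∫⁻ x, ‖g x‖ₑ ^ p ∂μ ≠ ⊤) :
    Integrable (fun x => F (g x)) μ := by
  obtain ⟨M, -, hM⟩ := exists_abs_le_mul_norm_rpow_of_homogeneous hF hp hom
  have hint : Integrable (fun x => ‖g x‖ ^ p) μ := by
    refine ⟨(hg.norm.aemeasurable.pow_const p).aestronglyMeasurable, ?_⟩
    rw [HasFiniteIntegral]
    simpa only [Real.enorm_rpow_of_nonneg (norm_nonneg _) hp.le, enorm_norm] using hgp.lt_top
  exact (hint.const_mul M).mono' (hF.comp_aestronglyMeasurable hg) (ae_of_all _ fun x => hM (g x))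

/-- Brezis–Lieb lemma for a continuous positively homogeneous function of degree `p`. -/
theorem tendsto_integral_brezis_lieb_of_homogeneous (hF : Continuous F) (hp : 0 < p)
    (hom : ∀ t : ℝ, 0 ≤ t → ∀ z, F (t • z) = t ^ p * F z)
    (hf : ∀ n, AEStronglyMeasurable (f n) μ) (hg : AEStronglyMeasurable g μ)
    (hlim : ∀ᵐ x ∂μ, Tendsto (fun n => f n x) atTop (𝓝 (g x)))
    (hKtop : K ≠ ⊤) (hK : ∀ n, ∫⁻ x, ‖f n x‖ₑ ^ p ∂μ ≤ K) :
    Tendsto (fun n => ∫ x, (F (f n x) - F (f n x - g x)) ∂μ) atTop (𝓝 (∫ x, F (g x) ∂μ)) := by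
  have hW := tendsto_lintegral_brezis_lieb_of_homogeneous hF hp hom hf hg hlim hKtop hK
  have hFg : Integrable (fun x => F (g x)) μ := integrable_comp_of_homogeneous hF hp hom hg
    (ne_top_of_le_ne_top hKtop (lintegral_enorm_rpow_le_of_tendsto_ae hf hlim hK))
  refine tendsto_integral_of_L1 _ hFg.aestronglyMeasurable ?_ hW
  filter_upwards [ENNReal.tendsto_nhds_zero.1 hW 1 one_pos] with n hn
  have hWi : Integrable (fun x => F (f n x) - F (f n x - g x) - F (g x)) μ :=
    ⟨((hF.comp_aestronglyMeasurable (hf n)).sub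
      (hF.comp_aestronglyMeasurable ((hf n).sub hg))).sub (hF.comp_aestronglyMeasurable hg),
      hn.trans_lt one_lt_top⟩
  exact (hWi.add hFg).congr (ae_of_all _ fun x => sub_add_cancel _ _)

end BrezisLieb

/-- Brezis–Lieb type splitting (Lemma 2.4 of the paper). -/
theorem brezis_lieb_splitting
    (N : ℕ) (hN : 1 ≤ N) (r1 r2 : ℝ) (hr1 : 1 < r1) (hr2 : 1 < r2)
    (h2star : 3 ≤ N → r1 + r2 ≤ 2 * (N : ℝ) / ((N : ℝ) - 2))
    (u v : ℕ → EucN N → ℝ) (u0 v0 : EucN N → ℝ)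
    (hum : ∀ n, Measurable (u n)) (hvm : ∀ n, Measurable (v n))
    (hu0m : Measurable u0) (hv0m : Measurable v0)
    (huconv : ∀ᵐ x : EucN N, Tendsto (fun n => u n x) atTop (nhds (u0 x)))
    (hvconv : ∀ᵐ x : EucN N, Tendsto (fun n => v n x) atTop (nhds (v0 x)))
    (hbound : (⨆ n : ℕ, ∫⁻ x : EucN N,
        (ENNReal.ofReal (|u n x| ^ (r1 + r2)) + ENNReal.ofReal (|v n x| ^ (r1 + r2)))) < ⊤) :
    Tendsto
      (fun n => ∫ x : EucN N,
        (|u n x| ^ r1 * |v n x| ^ r2 - |u n x - u0 x| ^ r1 * |v n x - v0 x| ^ r2))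
      atTop (nhds (∫ x : EucN N, |u0 x| ^ r1 * |v0 x| ^ r2)) := by
  have hp : 0 < r1 + r2 := by linarith
  have hF : Continuous fun z : ℝ × ℝ => |z.1| ^ r1 * |z.2| ^ r2 :=
    (continuous_fst.abs.rpow_const fun _ => Or.inr (by linarith)).mul
      (continuous_snd.abs.rpow_const fun _ => Or.inr (by linarith))
  have hom : ∀ t : ℝ, 0 ≤ t → ∀ z : ℝ × ℝ, |(t • z).1| ^ r1 * |(t • z).2| ^ r2
      = t ^ (r1 + r2) * (|z.1| ^ r1 * |z.2| ^ r2) := by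
    intro t ht z
    rw [Prod.smul_fst, Prod.smul_snd, smul_eq_mul, smul_eq_mul, abs_mul, abs_mul,
      abs_of_nonneg ht, Real.mul_rpow ht (abs_nonneg _), Real.mul_rpow ht (abs_nonneg _),
      Real.rpow_add_of_nonneg ht (by linarith) (by linarith)]
    ring
  refine tendsto_integral_brezis_lieb_of_homogeneous (f := fun n x => (u n x, v n x))
    (g := fun x => (u0 x, v0 x)) hF hp hom
    (fun n => ((hum n).prodMk (hvm n)).aestronglyMeasurable)
    (hu0m.prodMk hv0m).aestronglyMeasurable ?_ hbound.ne fun n => ?_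
  · filter_upwards [huconv, hvconv] with x hux hvx
    exact hux.prodMk_nhds hvx
  · refine le_iSup_of_le n (lintegral_mono fun x => ?_)
    have hofReal : ∀ a : ℝ, ENNReal.ofReal (|a| ^ (r1 + r2)) = ‖a‖ₑ ^ (r1 + r2) := fun a => by
      rw [← ENNReal.ofReal_rpow_of_nonneg (abs_nonneg a) hp.le, Real.enorm_eq_ofReal_abs]
    simp only [hofReal]
    rcases le_total ‖u n x‖ ‖v n x‖ with h | h
    · rw [← enorm_norm (u n x, v n x), Prod.norm_mk, max_eq_right h, enorm_norm]
      exact le_add_self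
    · rw [← enorm_norm (u n x, v n x), Prod.norm_mk, max_eq_left h, enorm_norm]
      exact le_self_add
end
end

section
/- Let a > 0 and b1, b2, c ≥ 0 be real numbers, and let q1, q2, r be real exponents with 0 < q1 < 2, 0 < q2 < 2, r > 2, q1 ≤ r − 1 and q2 ≤ r − 1. Define θ : (0,∞) → ℝ by θ(t) = (a/2)t² − b1·t^{q1} − b2·t^{q2} − c·t^{r} (real powers). Then the set {t ∈ (0,∞) : θ'(t) = 0} has at most two elements; i.e. the map t ↦ θ(t) admits at most two stationary points on (0,∞). -/
/-- A set of reals without three elements in increasing position is contained in a pair. -/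
theorem Set.exists_subset_pair_of_no_three_lt {S : Set ℝ}
    (h : ∀ x ∈ S, ∀ y ∈ S, ∀ z ∈ S, x < y → y < z → False) : ∃ x y : ℝ, S ⊆ {x, y} := by
  by_contra! hS
  obtain ⟨x, hx, -⟩ := Set.not_subset.1 (hS 0 0)
  obtain ⟨y, hy, hyx⟩ := Set.not_subset.1 (hS x x)
  obtain ⟨z, hz, hzxy⟩ := Set.not_subset.1 (hS x y)
  simp only [Set.mem_insert_iff, Set.mem_singleton_iff, not_or] at hyx hzxy
  rcases lt_or_gt_of_ne hyx.1 with h1 | h1 <;> rcases lt_or_gt_of_ne hzxy.1 with h2 | h2 <;>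
    rcases lt_or_gt_of_ne hzxy.2 with h3 | h3 <;> grind

/-- Strict convexity of `x ↦ t ^ k` in the variable `x = log t`. -/
theorem Real.rpow_lt_of_log_eq {k : ℝ} (hk : k ≠ 0) {x y z l m : ℝ} (hx : 0 < x) (hy : 0 < y)
    (hz : 0 < z) (hxz : x < z) (hl : 0 < l) (hm : 0 < m) (hlm : l + m = 1)
    (h : l * Real.log x + m * Real.log z = Real.log y) :
    y ^ k < l * x ^ k + m * z ^ k := by
  have hne : Real.log x * k ≠ Real.log z * k := fun he =>
    (Real.log_lt_log hx hxz).ne (mul_right_cancel₀ hk he)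
  have hconv := strictConvexOn_exp.2 (Set.mem_univ _) (Set.mem_univ _) hne hl hm hlm
  simp only [smul_eq_mul] at hconv
  rw [Real.rpow_def_of_pos hx, Real.rpow_def_of_pos hy, Real.rpow_def_of_pos hz, ← h, add_mul,
    mul_assoc, mul_assoc]
  exact hconv

/-- At a positive stationary point, the derivative divided by `t` vanishes. -/
theorem eq_sum_rpow_of_deriv_eq_zero {a b1 b2 c q1 q2 r t : ℝ} (ht : 0 < t)
    (h : deriv (fun s : ℝ => a / 2 * s ^ (2 : ℝ) - b1 * s ^ q1 - b2 * s ^ q2 - c * s ^ r) t = 0) :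
    b1 * q1 * t ^ (q1 - 2) + b2 * q2 * t ^ (q2 - 2) + c * r * t ^ (r - 2) = a := by
  have hd (p : ℝ) : HasDerivAt (fun s : ℝ => s ^ p) (p * (t ^ (p - 2) * t)) t := by
    convert Real.hasDerivAt_rpow_const (p := p) (Or.inl ht.ne') using 2
    rw [← Real.rpow_add_one ht.ne']
    ring_nf
  have hθ := ((((hd 2).const_mul (a / 2)).sub ((hd q1).const_mul b1)).sub
    ((hd q2).const_mul b2)).sub ((hd r).const_mul c)
  have h0 := hθ.deriv.symm.trans h
  rw [sub_self, Real.rpow_zero] at h0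
  apply mul_right_cancel₀ ht.ne'
  linarith

/-- First case of the appendix Lemma of the paper (Lemma 4.4/5.1): under `q_i ≤ r − 1`,
the fibering map `θ(t) = (a/2)t² − b1·t^{q1} − b2·t^{q2} − c·t^{r}` admits at most two
stationary points on `(0,∞)`. -/
theorem fibering_at_most_two_critical_points_case1
    (a b1 b2 c : ℝ) (ha : 0 < a) (hb1 : 0 ≤ b1) (hb2 : 0 ≤ b2) (hc : 0 ≤ c)
    (q1 q2 r : ℝ) (hq1 : 0 < q1) (hq1' : q1 < 2) (hq2 : 0 < q2) (hq2' : q2 < 2)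
    (hr : 2 < r) (h1 : q1 ≤ r - 1) (h2 : q2 ≤ r - 1) :
    ∃ t1 t2 : ℝ,
      {t : ℝ | 0 < t ∧
        deriv (fun s : ℝ => a / 2 * s ^ (2 : ℝ) - b1 * s ^ q1 - b2 * s ^ q2 - c * s ^ r) t
          = 0} ⊆ {t1, t2} := by
  apply Set.exists_subset_pair_of_no_three_lt
  rintro x ⟨hx, hdx⟩ y ⟨hy, hdy⟩ z ⟨hz, hdz⟩ hxy hyz
  have ex := eq_sum_rpow_of_deriv_eq_zero hx hdx
  have ey := eq_sum_rpow_of_deriv_eq_zero hy hdy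
  have ez := eq_sum_rpow_of_deriv_eq_zero hz hdz
  have hmem : Real.log y ∈ openSegment ℝ (Real.log x) (Real.log z) := by
    rw [openSegment_eq_Ioo ((Real.log_lt_log hx hxy).trans (Real.log_lt_log hy hyz))]
    exact ⟨Real.log_lt_log hx hxy, Real.log_lt_log hy hyz⟩
  obtain ⟨l, m, hl, hm, hlm, hlog⟩ := hmem
  have key (k : ℝ) (hk : k ≠ 0) : 0 < l * x ^ k + m * z ^ k - y ^ k :=
    sub_pos.2 (Real.rpow_lt_of_log_eq hk hx hy hz (hxy.trans hyz) hl hm hlm hlog)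
  have k1 := key (q1 - 2) (by linarith)
  have k2 := key (q2 - 2) (by linarith)
  have k3 := key (r - 2) (by linarith)
  have hB1 : 0 ≤ b1 * q1 := by positivity
  have hB2 : 0 ≤ b2 * q2 := by positivity
  have hC : 0 ≤ c * r := by positivity
  have n1 := mul_nonneg hB1 k1.le
  have n2 := mul_nonneg hB2 k2.le
  have n3 := mul_nonneg hC k3.le
  have hsum : b1 * q1 * (l * x ^ (q1 - 2) + m * z ^ (q1 - 2) - y ^ (q1 - 2)) +
      b2 * q2 * (l * x ^ (q2 - 2) + m * z ^ (q2 - 2) - y ^ (q2 - 2)) +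
      c * r * (l * x ^ (r - 2) + m * z ^ (r - 2) - y ^ (r - 2)) = 0 := by
    linear_combination l * ex + m * ez - ey + a * hlm
  have z1 := (mul_eq_zero.1 (by linarith : b1 * q1 * _ = 0)).resolve_right k1.ne'
  have z2 := (mul_eq_zero.1 (by linarith : b2 * q2 * _ = 0)).resolve_right k2.ne'
  have z3 := (mul_eq_zero.1 (by linarith : c * r * _ = 0)).resolve_right k3.ne'
  rw [z1, z2, z3] at ex
  linarith
end

section
/- Let a, b1, b2, c ≥ 0 be real numbers and let q1, q2, r be real exponents with 0 < q1 < 2, 0 < q2 < 2, r > 2, and such that either (q1 ≤ r − 1 and q2 ≤ r − 1) or |q1 − q2| ≤ 1. Define θ : (0,∞) → ℝ by θ(t) = (a/2)t² − b1·t^{q1} − b2·t^{q2} − c·t^{r} (real powers). If θ'(1) = 0 and θ(1) > 0, then θ(t) ≤ θ(1) for every t > 0; that is, θ attains its global maximum over (0,∞) at t = 1. -/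
/-- Convexity of the exponential `x ↦ t ^ x`, with denominators cleared. -/
lemma sub_mul_rpow_le_of_lt_of_lt {t x y z : ℝ} (ht : 0 < t) (hxy : x < y) (hyz : y < z) :
    (z - x) * t ^ y ≤ (z - y) * t ^ x + (y - x) * t ^ z := by
  have hzx : 0 < z - x := by linarith
  have h := Real.geom_mean_le_arith_mean2_weighted
    (div_nonneg (sub_nonneg.2 hyz.le) hzx.le) (div_nonneg (sub_nonneg.2 hxy.le) hzx.le)
    (Real.rpow_nonneg ht.le x) (Real.rpow_nonneg ht.le z)
    (by rw [← add_div, div_eq_one_iff_eq hzx.ne']; ring)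
  rw [← Real.rpow_mul ht.le, ← Real.rpow_mul ht.le, ← Real.rpow_add ht] at h
  have hexp : x * ((z - y) / (z - x)) + z * ((y - x) / (z - x)) = y := by
    field_simp
    ring
  rw [hexp] at h
  calc (z - x) * t ^ y
      ≤ (z - x) * ((z - y) / (z - x) * t ^ x + (y - x) / (z - x) * t ^ z) := by gcongr
    _ = (z - y) * t ^ x + (y - x) * t ^ z := by field_simp


/-- Lemma 4.3 of the paper: if the fibering map
`θ(t) = (a/2)t² − b1·t^{q1} − b2·t^{q2} − c·t^{r}` has a stationary point at `t = 1` with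
`θ(1) > 0`, then `θ` attains its global maximum over `(0,∞)` at `t = 1`. -/
theorem fibering_global_max_at_one
    (a b1 b2 c : ℝ) (ha : 0 ≤ a) (hb1 : 0 ≤ b1) (hb2 : 0 ≤ b2) (hc : 0 ≤ c)
    (q1 q2 r : ℝ) (hq1 : 0 < q1) (hq1' : q1 < 2) (hq2 : 0 < q2) (hq2' : q2 < 2)
    (hr : 2 < r)
    (hcase : (q1 ≤ r - 1 ∧ q2 ≤ r - 1) ∨ |q1 - q2| ≤ 1)
    (θ : ℝ → ℝ)
    (hθ : θ = fun t : ℝ => a / 2 * t ^ (2 : ℝ) - b1 * t ^ q1 - b2 * t ^ q2 - c * t ^ r)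
    (hcrit : deriv θ 1 = 0) (hpos : 0 < θ 1) :
    ∀ t : ℝ, 0 < t → θ t ≤ θ 1 := by
  intro t ht
  have hd : ∀ p : ℝ, HasDerivAt (fun t : ℝ => t ^ p) p 1 := fun p => by
    simpa using Real.hasDerivAt_rpow_const (x := 1) (p := p) (Or.inl one_ne_zero)
  have hderiv : HasDerivAt θ (a / 2 * 2 - b1 * q1 - b2 * q2 - c * r) 1 := by
    rw [hθ]
    exact ((((hd 2).const_mul (a / 2)).sub ((hd q1).const_mul b1)).sub
      ((hd q2).const_mul b2)).sub ((hd r).const_mul c)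
  rw [hderiv.deriv] at hcrit
  have ha_eq : a = b1 * q1 + b2 * q2 + c * r := by linarith
  simp only [hθ, Real.one_rpow] at hpos ⊢
  have h0 := sub_mul_rpow_le_of_lt_of_lt ht two_pos hr
  have h1 := sub_mul_rpow_le_of_lt_of_lt ht hq1' hr
  have h2 := sub_mul_rpow_le_of_lt_of_lt ht hq2' hr
  rw [Real.rpow_zero] at h0
  generalize t ^ (2 : ℝ) = T at *
  generalize t ^ q1 = T1 at *
  generalize t ^ q2 = T2 at *
  generalize t ^ r = R at *
  subst ha_eq
  have hR : 0 ≤ R - 1 - r / 2 * (T - 1) := by linarith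
  have hcoef : 0 ≤ c * (r - 2) - b1 * (2 - q1) - b2 * (2 - q2) := by linarith
  have hmul := mul_nonneg hcoef hR
  have e1 := mul_le_mul_of_nonneg_left h1 hb1
  have e2 := mul_le_mul_of_nonneg_left h2 hb2
  refine le_of_mul_le_mul_left ?_ (sub_pos.2 hr)
  linarith
end
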